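/- arXiv:1909.07365 — 4 statements merged into one kernel-verified Lean document; each statement's English description precedes it below -/
import Mathlib

section
/- Let q ≡ 3 (mod 4) be a prime power and let g ∈ 𝔽_q[t] be an irreducible polynomial with gcd(g, t(t−1)) = 1 and deg g even, such that t is not a square in the field 𝔽_q[t]/(g) and −1 is a square in 𝔽_q[t]/(g). Then for every natural number h and every (u₁,u₂,u₃,u₄) ∈ 𝔽_q[t]⁴ satisfying u₁² + u₂² − (t−1)(u₃² + u₄²) = t^h, with g dividing each of u₁, u₃, u₄, with gcd(u₂, g) = 1, and with (t−1) dividing both u₁ − 1 and u₂, one has h ≥ 4·deg g. -/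
open Polynomial
open scoped Classical

theorem eq_zero_of_sq_add_sq_eq_zero {F : Type*} [Field F] (hF : ¬ IsSquare (-1 : F)) {a b : F}
    (hab : a ^ 2 + b ^ 2 = 0) : b = 0 := by
  by_contra hb
  refine hF ⟨a / b, ?_⟩
  field_simp
  linear_combination -hab

theorem natDegree_sq_add_sq_of_le {F : Type*} [Field F] (hF : ¬ IsSquare (-1 : F)) {a b : F[X]}
    (hab : a.natDegree ≤ b.natDegree) : (a ^ 2 + b ^ 2).natDegree = 2 * b.natDegree := by
  by_cases hb : b = 0
  · subst hb
    simpa using hab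
  refine natDegree_eq_of_le_of_coeff_ne_zero ?_ ?_
  · refine (natDegree_add_le _ _).trans (max_le ?_ ?_)
    · exact natDegree_pow_le.trans (by lia)
    · exact natDegree_pow_le
  · rw [coeff_add, coeff_pow_of_natDegree_le hab, coeff_pow_of_natDegree_le le_rfl]
    exact fun h => hb (leadingCoeff_eq_zero.mp (eq_zero_of_sq_add_sq_eq_zero hF h))

theorem natDegree_sq_add_sq {F : Type*} [Field F] (hF : ¬ IsSquare (-1 : F)) (a b : F[X]) :
    (a ^ 2 + b ^ 2).natDegree = 2 * max a.natDegree b.natDegree := by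
  rcases le_total a.natDegree b.natDegree with hab | hab
  · rw [natDegree_sq_add_sq_of_le hF hab, max_eq_right hab]
  · rw [add_comm, natDegree_sq_add_sq_of_le hF hab, max_eq_left hab]

/-- No cancellation of leading terms occurs in `a² + b² - (t - 1)(c² + d²)`: the first two squares
contribute an even degree and the last two an odd one. -/
theorem natDegree_le_of_sq_add_sq_sub_eq_X_pow {F : Type*} [Field F] (hF : ¬ IsSquare (-1 : F))
    {a b c d : F[X]} {k : ℕ} (h : a ^ 2 + b ^ 2 - (X - 1) * (c ^ 2 + d ^ 2) = X ^ (2 * k)) :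
    b.natDegree ≤ k := by
  have hab := natDegree_sq_add_sq hF a b
  have hcd := natDegree_sq_add_sq hF c d
  have hdeg := congrArg natDegree h
  rw [natDegree_X_pow] at hdeg
  by_cases hz : c ^ 2 + d ^ 2 = 0
  · rw [hz, mul_zero, sub_zero, hab] at hdeg
    lia
  have hX : (X - 1 : F[X]).natDegree = 1 := by simpa using natDegree_X_sub_C (1 : F)
  have hX0 : (X - 1 : F[X]) ≠ 0 := ne_zero_of_natDegree_gt (n := 0) (by lia)
  have hQ := natDegree_mul hX0 hz
  rcases lt_or_ge (a ^ 2 + b ^ 2).natDegree ((X - 1) * (c ^ 2 + d ^ 2)).natDegree with hlt | hge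
  · rw [natDegree_sub_eq_right_of_natDegree_lt hlt] at hdeg
    lia
  · rw [natDegree_sub_eq_left_of_natDegree_lt (by lia)] at hdeg
    lia

/-- If an odd power of a unit is a square in a commutative ring, then so is the unit. -/
theorem exists_sq_eq_of_sq_eq_odd_pow {R : Type*} [CommRing R] {x y z : R} {k : ℕ}
    (hxz : x * z = 1) (hy : y ^ 2 = x ^ (2 * k + 1)) : (y * z ^ k) ^ 2 = x := by
  calc (y * z ^ k) ^ 2 = x * (x * z) ^ (2 * k) := by rw [mul_pow, hy]; ring
    _ = x := by rw [hxz, one_pow, mul_one]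

/-- Modulo the square of an irreducible polynomial coprime to `2x`, the only square roots of `x²`
are `x` and `-x`. -/
theorem sq_dvd_sub_or_sq_dvd_add {F : Type*} [Field F] {g x y : F[X]} (h2 : (2 : F) ≠ 0)
    (hg : Irreducible g) (hgx : IsCoprime g x) (h : g ^ 2 ∣ y ^ 2 - x ^ 2) :
    g ^ 2 ∣ y - x ∨ g ^ 2 ∣ y + x := by
  rw [sq_sub_sq] at h
  by_cases hd : g ∣ y - x
  · refine Or.inl (IsCoprime.dvd_of_dvd_mul_left ?_ h)
    refine ((hg.coprime_iff_not_dvd).mpr fun hs => ?_).pow_left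
    have h2x : g ∣ C 2 * x := by
      convert dvd_sub hs hd using 1
      rw [map_ofNat]
      ring
    have := hgx.dvd_of_dvd_mul_right h2x
    exact hg.not_isUnit (isUnit_of_dvd_unit this (isUnit_C.mpr h2.isUnit))
  · exact Or.inr (IsCoprime.dvd_of_dvd_mul_right ((hg.coprime_iff_not_dvd).mpr hd).pow_left h)

/-- **Diameter lower bound, bipartite case (key diophantine step).**
If `q ≡ 3 (mod 4)`, `g ∈ 𝔽_q[t]` is irreducible, coprime to `t(t−1)`, of even degree,
`t` is a non-square and `−1` is a square modulo `g`, then any solution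
`u₁² + u₂² − (t−1)(u₃² + u₄²) = t^h` with `g ∣ u₁, u₃, u₄`, `gcd(u₂,g) = 1`,
`(t−1) ∣ u₁ − 1` and `(t−1) ∣ u₂` satisfies `h ≥ 4·deg g`. -/
theorem stmt_1 (Fq : Type) [Field Fq] [Fintype Fq] (hq : Fintype.card Fq % 4 = 3)
    (g : Polynomial Fq) (hgirr : Irreducible g)
    (hgcop : IsCoprime g (Polynomial.X * (Polynomial.X - 1)))
    (hgeven : Even g.natDegree)
    (htns : ¬ ∃ y : Polynomial Fq ⧸ Ideal.span {g},
      y ^ 2 = Ideal.Quotient.mk (Ideal.span {g}) Polynomial.X)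
    (hm1sq : ∃ y : Polynomial Fq ⧸ Ideal.span {g}, y ^ 2 = -1)
    (h : ℕ) (u₁ u₂ u₃ u₄ : Polynomial Fq)
    (heq : u₁ ^ 2 + u₂ ^ 2 - (Polynomial.X - 1) * (u₃ ^ 2 + u₄ ^ 2) = Polynomial.X ^ h)
    (hu1 : g ∣ u₁) (hu3 : g ∣ u₃) (hu4 : g ∣ u₄)
    (hu2 : IsCoprime u₂ g)
    (ht1 : (Polynomial.X - 1) ∣ (u₁ - 1)) (ht2 : (Polynomial.X - 1) ∣ u₂) :
    4 * g.natDegree ≤ h := by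
  have hF : ¬ IsSquare (-1 : Fq) := fun hs => FiniteField.isSquare_neg_one_iff.mp hs hq
  have h2 : (2 : Fq) ≠ 0 := fun h0 => hF ⟨1, by linear_combination -h0⟩
  have hgX : IsCoprime g X := hgcop.of_mul_right_left
  have hdvd : g ^ 2 ∣ u₂ ^ 2 - X ^ h := by
    have h1 := pow_dvd_pow_of_dvd hu1 2
    have h34 := (dvd_add (pow_dvd_pow_of_dvd hu3 2) (pow_dvd_pow_of_dvd hu4 2)).mul_left (X - 1)
    convert dvd_sub h34 h1 using 1
    linear_combination heq
  rcases Nat.even_or_odd' h with ⟨k, rfl | rfl⟩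
  · have hu2deg := natDegree_le_of_sq_add_sq_sub_eq_X_pow hF heq
    have bound (w : Fq[X]) (hw : w.natDegree = k) (hw1 : w.eval 1 ≠ 0) (hdw : g ^ 2 ∣ u₂ + w) :
        4 * g.natDegree ≤ 2 * k := by
      have hne : u₂ + w ≠ 0 := fun h0 => hw1 <| by
        obtain ⟨v, rfl⟩ := ht2
        simpa using congrArg (eval 1) h0
      have h1 := natDegree_le_of_dvd hdw hne
      have h3 := natDegree_add_le u₂ w
      rw [natDegree_pow] at h1
      lia
    rw [mul_comm 2 k, pow_mul] at hdvd
    rcases sq_dvd_sub_or_sq_dvd_add h2 hgirr hgX.pow_right hdvd with hd | hd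
    · exact bound (-X ^ k) (by simp) (by simp) (by rwa [← sub_eq_add_neg])
    · exact bound (X ^ k) (by simp) (by simp) hd
  · obtain ⟨a, b, hab⟩ := hgX
    let π := Ideal.Quotient.mk (Ideal.span {g})
    have hπ {p r : Fq[X]} (hpr : g ∣ p - r) : π p = π r :=
      Ideal.Quotient.eq.mpr (Ideal.mem_span_singleton.mpr hpr)
    have hinv : π X * π b = 1 := by
      rw [← map_mul, ← map_one π]
      exact hπ ⟨-a, by linear_combination hab⟩
    have hsq : π u₂ ^ 2 = π X ^ (2 * k + 1) := by
      rw [← map_pow, ← map_pow]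
      exact hπ ((dvd_pow_self g two_ne_zero).trans hdvd)
    exact (htns ⟨_, exists_sq_eq_of_sq_eq_odd_pow hinv hsq⟩).elim
end

section
/- Let q ≡ 3 (mod 4) be a prime power and let r ∈ 𝔽_q[t] be an irreducible polynomial with gcd(r, t(t−1)) = 1. Suppose a = (a₁,a₂,a₃,a₄) ∈ 𝔽_q[t]⁴ and a natural number h satisfy a₁² + a₂² − (t−1)(a₃² + a₄²) = t^h, r divides each of a₂, a₃, a₄, (a₃, a₄) ≠ (0,0), and h < 4·deg r. Then h is odd. -/
open Polynomial
open scoped Classical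

theorem eq_zero_and_eq_zero_of_sq_add_sq_eq_zero {F : Type*} [Field F] (hF : ¬IsSquare (-1 : F))
    {x y : F} (hxy : x ^ 2 + y ^ 2 = 0) : x = 0 ∧ y = 0 := by
  have hy : y = 0 := by
    by_contra hy
    refine hF ⟨x / y, ?_⟩
    field_simp
    linear_combination -hxy
  exact ⟨by simpa [hy] using hxy, hy⟩

namespace Polynomial

variable {F : Type*} [Field F]

theorem coeff_sq_add_sq_ne_zero (hF : ¬IsSquare (-1 : F)) {a b : F[X]} (hab : ¬(a = 0 ∧ b = 0)) :
    (a ^ 2 + b ^ 2).coeff (2 * max a.natDegree b.natDegree) ≠ 0 := by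
  rw [coeff_add, coeff_pow_of_natDegree_le (le_max_left _ _),
    coeff_pow_of_natDegree_le (le_max_right _ _)]
  intro h0
  obtain ⟨ha, hb⟩ := eq_zero_and_eq_zero_of_sq_add_sq_eq_zero hF h0
  rcases le_total a.natDegree b.natDegree with h | h
  · rw [max_eq_right h] at ha hb
    have hb0 : b = 0 := leadingCoeff_eq_zero.mp hb
    rw [hb0, natDegree_zero] at h ha
    exact hab ⟨by rw [eq_C_of_natDegree_le_zero h, ha, C_0], hb0⟩
  · rw [max_eq_left h] at ha hb
    have ha0 : a = 0 := leadingCoeff_eq_zero.mp ha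
    rw [ha0, natDegree_zero] at h hb
    exact hab ⟨ha0, by rw [eq_C_of_natDegree_le_zero h, hb, C_0]⟩

theorem natDegree_sq_add_sq (hF : ¬IsSquare (-1 : F)) (a b : F[X]) :
    (a ^ 2 + b ^ 2).natDegree = 2 * max a.natDegree b.natDegree := by
  by_cases hab : a = 0 ∧ b = 0
  · simp [hab.1, hab.2]
  refine le_antisymm (natDegree_add_le_of_degree_le ?_ ?_)
    (le_natDegree_of_ne_zero (coeff_sq_add_sq_ne_zero hF hab))
  · exact natDegree_pow_le_of_le 2 (le_max_left _ _)
  · exact natDegree_pow_le_of_le 2 (le_max_right _ _)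

theorem natDegree_X_sub_one_mul_sq_add_sq (hF : ¬IsSquare (-1 : F)) {a b : F[X]}
    (hab : ¬(a = 0 ∧ b = 0)) :
    ((X - 1) * (a ^ 2 + b ^ 2)).natDegree = 1 + 2 * max a.natDegree b.natDegree := by
  have h0 : a ^ 2 + b ^ 2 ≠ 0 := fun h => coeff_sq_add_sq_ne_zero hF hab (by rw [h, coeff_zero])
  have h1 : (X - 1 : F[X]).natDegree = 1 := natDegree_X_sub_C (1 : F)
  have h2 : (X - 1 : F[X]) ≠ 0 := X_sub_C_ne_zero (1 : F)
  rw [natDegree_mul h2 h0, h1, natDegree_sq_add_sq hF]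

/-- The two binary forms have degrees of opposite parity, so their leading terms cannot cancel. -/
theorem natDegree_le_of_sq_add_sq_sub (hF : ¬IsSquare (-1 : F)) {a b c d : F[X]}
    (hcd : ¬(c = 0 ∧ d = 0)) :
    2 * a.natDegree ≤ (a ^ 2 + b ^ 2 - (X - 1) * (c ^ 2 + d ^ 2)).natDegree := by
  have hP := natDegree_sq_add_sq hF a b
  have hQ := natDegree_X_sub_one_mul_sq_add_sq hF hcd
  have ha := le_max_left a.natDegree b.natDegree
  rcases lt_or_ge (a ^ 2 + b ^ 2).natDegree ((X - 1) * (c ^ 2 + d ^ 2)).natDegree with h | h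
  · rw [natDegree_sub_eq_right_of_natDegree_lt h]
    omega
  · rw [natDegree_sub_eq_left_of_natDegree_lt (by omega)]
    omega

theorem X_sub_one_mul_sq_add_sq_ne_sq (hF : ¬IsSquare (-1 : F)) {b c d : F[X]}
    (hcd : ¬(c = 0 ∧ d = 0)) : (X - 1) * (c ^ 2 + d ^ 2) ≠ b ^ 2 := by
  intro h
  have hQ := natDegree_X_sub_one_mul_sq_add_sq hF hcd
  rw [h, natDegree_pow] at hQ
  omega

end Polynomial

theorem Prime.sq_dvd_or_sq_dvd_of_dvd_mul {R : Type*} [CommRing R] [IsDomain R] {p x y : R}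
    (hp : Prime p) (hxy : p ^ 2 ∣ x * y) (h : ¬p ∣ x + y) : p ^ 2 ∣ x ∨ p ^ 2 ∣ y := by
  by_cases hx : p ∣ x
  · exact .inl (hp.pow_dvd_of_dvd_mul_right 2 (fun hy => h (dvd_add hx hy)) hxy)
  · exact .inr (hp.pow_dvd_of_dvd_mul_left 2 hx hxy)

/-- **Parity of the exponent.** If `q ≡ 3 (mod 4)`, `r ∈ 𝔽_q[t]` is irreducible and coprime to
`t(t−1)`, and `a₁² + a₂² − (t−1)(a₃² + a₄²) = t^h` with `r ∣ a₂, a₃, a₄`, `(a₃,a₄) ≠ (0,0)`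
and `h < 4·deg r`, then `h` is odd. -/
theorem stmt_3 (Fq : Type) [Field Fq] [Fintype Fq] (hq : Fintype.card Fq % 4 = 3)
    (r : Polynomial Fq) (hrirr : Irreducible r)
    (hrcop : IsCoprime r (Polynomial.X * (Polynomial.X - 1)))
    (a₁ a₂ a₃ a₄ : Polynomial Fq) (h : ℕ)
    (heq : a₁ ^ 2 + a₂ ^ 2 - (Polynomial.X - 1) * (a₃ ^ 2 + a₄ ^ 2) = Polynomial.X ^ h)
    (h2 : r ∣ a₂) (h3 : r ∣ a₃) (h4 : r ∣ a₄)
    (hne : ¬(a₃ = 0 ∧ a₄ = 0)) (hlt : h < 4 * r.natDegree) :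
    Odd h := by
  have hF : ¬IsSquare (-1 : Fq) := fun hs => FiniteField.isSquare_neg_one_iff.mp hs hq
  have hchar : (2 : Fq) ≠ 0 := fun h20 => hF ⟨1, by linear_combination -h20⟩
  rw [← Nat.not_even_iff_odd]
  rintro ⟨m, rfl⟩
  have hdeg : a₁.natDegree ≤ m := by
    have := natDegree_le_of_sq_add_sq_sub hF (a := a₁) (b := a₂) hne
    rw [heq, natDegree_X_pow] at this
    omega
  have hsq : r ^ 2 ∣ (X ^ m - a₁) * (X ^ m + a₁) := by
    have hdiff : (X ^ m - a₁) * (X ^ m + a₁) = a₂ ^ 2 - (X - 1) * (a₃ ^ 2 + a₄ ^ 2) := by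
      linear_combination -heq
    rw [hdiff]
    exact dvd_sub (pow_dvd_pow_of_dvd h2 2) <| Dvd.dvd.mul_left
      (dvd_add (pow_dvd_pow_of_dvd h3 2) (pow_dvd_pow_of_dvd h4 2)) _
  have hnd : ¬r ∣ (X ^ m - a₁) + (X ^ m + a₁) := by
    have hsum : (X ^ m - a₁) + (X ^ m + a₁) = C 2 * X ^ m := by
      rw [C_ofNat]
      ring
    rw [hsum, (isUnit_C.mpr (isUnit_iff_ne_zero.mpr hchar)).dvd_mul_left]
    exact fun hr => hrirr.not_isUnit
      ((hrcop.of_isCoprime_of_dvd_right (dvd_mul_right _ _)).pow_right.isUnit_of_dvd' dvd_rfl hr)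
  have hlt' : m < (r ^ 2).natDegree := by
    rw [natDegree_pow]
    omega
  have ha₁ : a₁ ^ 2 = X ^ (m + m) := by
    rcases hrirr.prime.sq_dvd_or_sq_dvd_of_dvd_mul hsq hnd with hd | hd
    · have h0 := eq_zero_of_dvd_of_natDegree_lt hd
        ((natDegree_sub_le_of_le (natDegree_X_pow_le m) hdeg).trans_lt (by simpa using hlt'))
      linear_combination -(X ^ m + a₁) * h0
    · have h0 := eq_zero_of_dvd_of_natDegree_lt hd
        ((natDegree_add_le_of_degree_le (natDegree_X_pow_le m) hdeg).trans_lt hlt')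
      linear_combination -(X ^ m - a₁) * h0
  exact X_sub_one_mul_sq_add_sq_ne_sq hF (b := a₂) hne (by linear_combination ha₁ - heq)
end

section
/- With the delta-method data for the Morgenstern quadratic form, let r ∈ 𝔽_q[t] be monic with q^{Q−3} < |r| ≤ q^Q and let c⃗ ∈ 𝔽_q[t]⁴ satisfy κ = |r|/q^R. If deg f is even, then I_{g,r}(c⃗) = 0. -/
open Polynomial MeasureTheory
open scoped Classical
noncomputable section
variable (Fq : Type) [Field Fq] [Fintype Fq]
abbrev Kinf := LaurentSeries Fq
def tK : Kinf Fq := HahnSeries.single (-1 : ℤ) 1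
def polyToK : Polynomial Fq →+* Kinf Fq := Polynomial.eval₂RingHom HahnSeries.C (tK Fq)
def absK (α : Kinf Fq) : ℝ :=
  if α = 0 then 0 else (Fintype.card Fq : ℝ) ^ (-(HahnSeries.order α))
def eFq (a : Fq) : ℂ :=
  letI : Algebra (ZMod (ringChar Fq)) Fq := ZMod.algebra _ _
  Complex.exp (2 * Real.pi * Complex.I *
    (((ZMod.val (Algebra.trace (ZMod (ringChar Fq)) Fq a)) : ℂ) / (ringChar Fq : ℂ)))
def psiK (α : Kinf Fq) : ℂ := eFq Fq (α.coeff 1)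
def polysLT (d : ℕ) : Finset (Polynomial Fq) :=
  (Finset.univ : Finset (Fin d → Fq)).image fun c =>
    ∑ i : Fin d, Polynomial.C (c i) * Polynomial.X ^ (i : ℕ)
def invMod (v r : Polynomial Fq) : Polynomial Fq :=
  Polynomial.C ((EuclideanDomain.gcd v r).coeff 0)⁻¹ * EuclideanDomain.gcdA v r
def psirP (r x : Polynomial Fq) : ℂ := psiK Fq (polyToK Fq x / polyToK Fq r)
def coprimeReps (r : Polynomial Fq) : Finset (Polynomial Fq) :=
  (polysLT Fq r.natDegree).filter fun x => IsCoprime x r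
def KinfMS : MeasurableSpace (Kinf Fq) :=
  MeasurableSpace.generateFrom
    {s : Set (Kinf Fq) | ∃ (a : Kinf Fq) (n : ℤ),
      s = {x | absK Fq (x - a) < (Fintype.card Fq : ℝ) ^ n}}
def KlInf (μ : @Measure (Kinf Fq) (KinfMS Fq)) (α : Kinf Fq) : ℂ :=
  letI := KinfMS Fq
  if h : ∃ l : ℤ, absK Fq α = (Fintype.card Fq : ℝ) ^ (2 * l) then
    ∫ x in {x : Kinf Fq | absK Fq x = (Fintype.card Fq : ℝ) ^ h.choose},
      psiK Fq (α / x + x) ∂μ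
  else 0
def hwt (x y : Kinf Fq) : ℝ := if absK Fq y < absK Fq x then (absK Fq x)⁻¹ else 0
def normV (x : Fin 4 → Kinf Fq) : ℝ :=
  Finset.univ.sup' Finset.univ_nonempty fun i => absK Fq (x i)

/-- The Morgenstern coefficients `η = (1, −ν, −(t−1), ν(t−1))`. -/
def eta (ν : Fq) : Fin 4 → Polynomial Fq :=
  ![1, -Polynomial.C ν, -(Polynomial.X - 1), Polynomial.C ν * (Polynomial.X - 1)]

/-- The Morgenstern quadratic form on polynomial quadruples. -/
def FmP (ν : Fq) (u : Fin 4 → Polynomial Fq) : Polynomial Fq := ∑ i, eta Fq ν i * u i ^ 2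

/-- The Morgenstern quadratic form on `K_∞⁴`. -/
def FmK (ν : Fq) (v : Fin 4 → Kinf Fq) : Kinf Fq := ∑ i, polyToK Fq (eta Fq ν i) * v i ^ 2

/-- The dual Morgenstern form `F*(c) = ∑ c_i²/η_i`, as an element of `K_∞`. -/
def FstarK (ν : Fq) (c : Fin 4 → Polynomial Fq) : Kinf Fq :=
  ∑ i, polyToK Fq (c i) ^ 2 / polyToK Fq (eta Fq ν i)

/-- The dual Morgenstern form as a rational function. -/
def FstarQ (ν : Fq) (c : Fin 4 → Polynomial Fq) : RatFunc Fq :=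
  ∑ i, algebraMap (Polynomial Fq) (RatFunc Fq) (c i) ^ 2 /
    algebraMap (Polynomial Fq) (RatFunc Fq) (eta Fq ν i)

/-- `R = ⌊deg f/2⌋ − deg g + 1`. -/
def Rdeg (f g : Polynomial Fq) : ℤ := ((f.natDegree / 2 : ℕ) : ℤ) - (g.natDegree : ℤ) + 1

/-- `Q = R + 1`. -/
def Qdeg (f g : Polynomial Fq) : ℤ := Rdeg Fq f g + 1

/-- `k = (f − F(λ))/g`. -/
def kdat (ν : Fq) (g f : Polynomial Fq) (lam : Fin 4 → Polynomial Fq) : Polynomial Fq :=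
  (f - FmP Fq ν lam) / g

/-- `G(t⃗) = F(t⃗) + (2λᵀAt⃗ − k)/g`. -/
def Gfun (ν : Fq) (g f : Polynomial Fq) (lam : Fin 4 → Polynomial Fq)
    (v : Fin 4 → Kinf Fq) : Kinf Fq :=
  FmK Fq ν v + (polyToK Fq g)⁻¹ *
    (2 * ∑ i, polyToK Fq (eta Fq ν i * lam i) * v i - polyToK Fq (kdat Fq ν g f lam))

/-- the weight `w`: indicator of `|x⃗|² ≤ |f|`. -/
def wInd (f : Polynomial Fq) (x : Fin 4 → Kinf Fq) : ℝ :=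
  if (normV Fq x) ^ 2 ≤ absK Fq (polyToK Fq f) then 1 else 0

/-- `κ = max_i |c_i/g|`. -/
def kappaC (g : Polynomial Fq) (c : Fin 4 → Polynomial Fq) : ℝ :=
  Finset.univ.sup' Finset.univ_nonempty fun i => absK Fq (polyToK Fq (c i) / polyToK Fq g)

/-- The oscillatory integral `I_{g,r}(c⃗)` for the Morgenstern form. -/
def Igr (μ : @Measure (Kinf Fq) (KinfMS Fq)) (ν : Fq) (g f : Polynomial Fq)
    (lam : Fin 4 → Polynomial Fq) (r : Polynomial Fq) (c : Fin 4 → Polynomial Fq) : ℂ :=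
  letI := KinfMS Fq
  ∫ v : Fin 4 → Kinf Fq,
    (((hwt Fq (polyToK Fq r / tK Fq ^ Qdeg Fq f g)
          (Gfun Fq ν g f lam v / tK Fq ^ (2 * Qdeg Fq f g)) *
        wInd Fq f (fun i => polyToK Fq g * v i + polyToK Fq (lam i)) : ℝ) : ℂ) *
      psiK Fq ((∑ i, polyToK Fq (c i) * v i) / (polyToK Fq g * polyToK Fq r)))
    ∂(Measure.pi fun _ : Fin 4 => μ)

/-- The exponential sum `S_{g,r}(c⃗)` for the Morgenstern form. -/
def SgrM (ν : Fq) (g f : Polynomial Fq) (lam : Fin 4 → Polynomial Fq)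
    (r : Polynomial Fq) (c : Fin 4 → Polynomial Fq) : ℂ :=
  ∑ l ∈ polysLT Fq g.natDegree, ∑ a ∈ coprimeReps Fq r,
    ∑ b ∈ Fintype.piFinset (fun _ : Fin 4 => polysLT Fq (g * r).natDegree),
      psirP Fq (g * r)
        ((a + r * l) * (2 * (∑ i, eta Fq ν i * lam i * b i) - kdat Fq ν g f lam)
          + a * g * FmP Fq ν b - ∑ i, c i * b i)

/-- `μ` is the additive Haar measure on `K_∞` normalized by `μ(𝕋) = 1`:
it is translation invariant and gives the unit ball measure `1`. -/
def IsHaar (μ : @Measure (Kinf Fq) (KinfMS Fq)) : Prop :=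
  (∀ (a : Kinf Fq) (s : Set (Kinf Fq)), μ ((a + ·) ⁻¹' s) = μ s) ∧
    μ {x : Kinf Fq | absK Fq x < 1} = 1

section AbsoluteValue

variable {Fq}

lemma one_lt_card_cast : (1 : ℝ) < Fintype.card Fq := by
  exact_mod_cast Fintype.one_lt_card

lemma card_cast_pos : (0 : ℝ) < Fintype.card Fq := zero_lt_one.trans one_lt_card_cast

lemma absK_nonneg (x : Kinf Fq) : 0 ≤ absK Fq x := by
  unfold absK
  split_ifs
  · exact le_rfl
  · exact (zpow_pos card_cast_pos _).le

lemma absK_of_ne_zero {x : Kinf Fq} (hx : x ≠ 0) :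
    absK Fq x = (Fintype.card Fq : ℝ) ^ (-x.order) := if_neg hx

lemma absK_pos {x : Kinf Fq} (hx : x ≠ 0) : 0 < absK Fq x := by
  rw [absK_of_ne_zero hx]
  exact zpow_pos card_cast_pos _

lemma absK_mul (x y : Kinf Fq) : absK Fq (x * y) = absK Fq x * absK Fq y := by
  by_cases hx : x = 0
  · simp [absK, hx]
  by_cases hy : y = 0
  · simp [absK, hy]
  rw [absK_of_ne_zero hx, absK_of_ne_zero hy, absK_of_ne_zero (mul_ne_zero hx hy),
    HahnSeries.order_mul hx hy, ← zpow_add₀ card_cast_pos.ne']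
  congr 1
  ring

lemma absK_one : absK Fq 1 = 1 := by
  simp [absK]

lemma absK_neg (x : Kinf Fq) : absK Fq (-x) = absK Fq x := by
  simp [absK]

lemma absK_div (x y : Kinf Fq) : absK Fq (x / y) = absK Fq x / absK Fq y := by
  by_cases hy : y = 0
  · simp [absK, hy]
  · rw [eq_div_iff (absK_pos hy).ne', ← absK_mul, div_mul_cancel₀ _ hy]

lemma absK_pow (x : Kinf Fq) (n : ℕ) : absK Fq (x ^ n) = absK Fq x ^ n := by
  induction n with
  | zero => simp [absK_one]
  | succ n ih => rw [pow_succ, pow_succ, absK_mul, ih]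

lemma absK_add_le_max (x y : Kinf Fq) :
    absK Fq (x + y) ≤ max (absK Fq x) (absK Fq y) := by
  by_cases hx : x = 0
  · simp [hx]
  by_cases hy : y = 0
  · simp [hy]
  by_cases hxy : x + y = 0
  · rw [hxy]
    exact le_max_of_le_left (by simpa [absK] using absK_nonneg x)
  rw [absK_of_ne_zero hx, absK_of_ne_zero hy, absK_of_ne_zero hxy, le_max_iff,
    zpow_le_zpow_iff_right₀ one_lt_card_cast, zpow_le_zpow_iff_right₀ one_lt_card_cast]
  have := HahnSeries.min_order_le_order_add hxy
  rw [min_le_iff] at this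
  omega

lemma absK_add_le {x y : Kinf Fq} {B : ℝ} (hx : absK Fq x ≤ B) (hy : absK Fq y ≤ B) :
    absK Fq (x + y) ≤ B :=
  (absK_add_le_max x y).trans (max_le hx hy)

lemma absK_sum_le {ι : Type*} (s : Finset ι) (u : ι → Kinf Fq) {B : ℝ} (hB : 0 ≤ B)
    (h : ∀ i ∈ s, absK Fq (u i) ≤ B) : absK Fq (∑ i ∈ s, u i) ≤ B :=
  Finset.sum_induction u (fun x => absK Fq x ≤ B) (fun _ _ => absK_add_le)
    (by simpa [absK] using hB) h

lemma absK_single (m : ℤ) {b : Fq} (hb : b ≠ 0) :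
    absK Fq (HahnSeries.single m b) = (Fintype.card Fq : ℝ) ^ (-m) := by
  rw [absK_of_ne_zero (by simpa using hb), HahnSeries.order_single hb]

lemma absK_tK_zpow (n : ℤ) : absK Fq (tK Fq ^ n) = (Fintype.card Fq : ℝ) ^ n := by
  have h : absK Fq (tK Fq) = Fintype.card Fq := by
    rw [tK, absK_single _ one_ne_zero]
    simp
  cases n with
  | ofNat n => simp [absK_pow, h]
  | negSucc n =>
    rw [zpow_negSucc, zpow_negSucc, ← one_div, absK_div, absK_one, absK_pow, h, one_div]

lemma absK_eq_of_coeff {x : Kinf Fq} {m : ℤ} (hm : x.coeff m ≠ 0)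
    (hlt : ∀ k < m, x.coeff k = 0) : absK Fq x = (Fintype.card Fq : ℝ) ^ (-m) := by
  have hx : x ≠ 0 := by
    rintro rfl
    simp at hm
  rw [absK_of_ne_zero hx]
  congr 2
  refine le_antisymm (HahnSeries.order_le_of_coeff_ne_zero hm) (not_lt.1 fun h => ?_)
  exact HahnSeries.coeff_order_eq_zero.not.2 hx (hlt _ h)

lemma absK_lt_one_of_coeff {x : Kinf Fq} (h : ∀ k ≤ 0, x.coeff k = 0) : absK Fq x < 1 := by
  by_cases hx : x = 0
  · simp [absK, hx]
  rw [absK_of_ne_zero hx]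
  refine zpow_lt_one_of_neg₀ one_lt_card_cast ?_
  by_contra! hle
  exact HahnSeries.coeff_order_eq_zero.not.2 hx (h _ (by omega))

lemma polyToK_monomial (n : ℕ) (a : Fq) :
    polyToK Fq (monomial n a) = HahnSeries.single (-(n : ℤ)) a := by
  simp [polyToK, tK, HahnSeries.single_pow, HahnSeries.C_apply]

lemma coeff_polyToK (p : Polynomial Fq) (m : ℤ) :
    (polyToK Fq p).coeff m = if m ≤ 0 then p.coeff (-m).toNat else 0 := by
  induction p using Polynomial.induction_on' with
  | add p q hp hq =>
    rw [map_add, HahnSeries.coeff_add, hp, hq]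
    split_ifs <;> simp
  | monomial n a =>
    rw [polyToK_monomial, HahnSeries.coeff_single, coeff_monomial]
    split_ifs <;> first | rfl | omega

lemma absK_polyToK {p : Polynomial Fq} (hp : p ≠ 0) :
    absK Fq (polyToK Fq p) = (Fintype.card Fq : ℝ) ^ (p.natDegree : ℤ) := by
  rw [absK_eq_of_coeff (m := -(p.natDegree : ℤ)), neg_neg]
  · rw [coeff_polyToK, if_pos (by omega)]
    simpa using hp
  · intro k hk
    rw [coeff_polyToK, if_pos (by omega)]
    exact coeff_eq_zero_of_natDegree_lt (by omega)

lemma polyToK_ne_zero {p : Polynomial Fq} (hp : p ≠ 0) : polyToK Fq p ≠ 0 := by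
  intro h
  have := absK_polyToK hp
  rw [h] at this
  simp [absK] at this
  exact (pow_pos (card_cast_pos (Fq := Fq)) p.natDegree).ne this

lemma exists_absK_sub_polyToK_lt_one (x : Kinf Fq) :
    ∃ p : Polynomial Fq, absK Fq (x - polyToK Fq p) < 1 := by
  let N : ℕ := (-x.order).toNat + 1
  refine ⟨∑ i ∈ Finset.range N, monomial i (x.coeff (-(i : ℤ))),
    absK_lt_one_of_coeff fun k hk => ?_⟩
  rw [HahnSeries.coeff_sub, coeff_polyToK, if_pos hk, finsetSum_coeff]
  simp only [coeff_monomial, Finset.sum_ite_eq', Finset.mem_range]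
  split_ifs with h
  · rw [show -(((-k).toNat : ℕ) : ℤ) = k by omega, sub_self]
  · rw [HahnSeries.coeff_eq_zero_of_lt_order (by omega), sub_zero]

end AbsoluteValue

section Character

variable {Fq}

lemma eFq_eq_stdAddChar [NeZero (ringChar Fq)] (a : Fq) :
    letI : Algebra (ZMod (ringChar Fq)) Fq := ZMod.algebra _ _
    eFq Fq a = ZMod.stdAddChar (Algebra.trace (ZMod (ringChar Fq)) Fq a) := by
  rw [ZMod.stdAddChar_apply, ZMod.toCircle_apply, eFq, mul_div_assoc]

lemma neZero_ringChar : NeZero (ringChar Fq) :=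
  ⟨CharP.ringChar_ne_zero_of_finite Fq⟩

lemma psiK_add (x y : Kinf Fq) : psiK Fq (x + y) = psiK Fq x * psiK Fq y := by
  have := neZero_ringChar (Fq := Fq)
  let : Algebra (ZMod (ringChar Fq)) Fq := ZMod.algebra _ _
  simp only [psiK, eFq_eq_stdAddChar, HahnSeries.coeff_add, map_add, AddChar.map_add_eq_mul]

lemma exists_eFq_mul_ne_one {a : Fq} (ha : a ≠ 0) : ∃ b, eFq Fq (b * a) ≠ 1 := by
  have := neZero_ringChar (Fq := Fq)
  let : Algebra (ZMod (ringChar Fq)) Fq := ZMod.algebra _ _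
  obtain ⟨b, hb⟩ := FiniteField.trace_to_zmod_nondegenerate Fq ha
  refine ⟨b, fun h => hb ?_⟩
  rw [eFq_eq_stdAddChar, mul_comm, ← AddChar.map_zero_eq_one (ZMod.stdAddChar (N := ringChar Fq))] at h
  exact ZMod.injective_stdAddChar h

/-- An element of absolute value `q^{-n}` pairs nontrivially with some element of
absolute value at most `q^{n-1}`. -/
lemma exists_psiK_mul_ne_one {d : Kinf Fq} {n : ℤ}
    (hd : absK Fq d = (Fintype.card Fq : ℝ) ^ (-n)) :
    ∃ a : Kinf Fq, absK Fq a = (Fintype.card Fq : ℝ) ^ (n - 1) ∧ psiK Fq (d * a) ≠ 1 := by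
  have hd0 : d ≠ 0 := by
    rintro rfl
    simp [absK] at hd
    exact (zpow_pos (card_cast_pos (Fq := Fq)) n).ne hd
  have hord : d.order = n := by
    rw [absK_of_ne_zero hd0] at hd
    have := zpow_right_injective₀ card_cast_pos one_lt_card_cast.ne' hd
    simpa using this
  have hcoeff : d.coeff n ≠ 0 := hord ▸ HahnSeries.coeff_order_eq_zero.not.2 hd0
  obtain ⟨b, hb⟩ := exists_eFq_mul_ne_one hcoeff
  have hb0 : b ≠ 0 := by
    rintro rfl
    have := neZero_ringChar (Fq := Fq)
    exact hb (by rw [zero_mul, eFq_eq_stdAddChar]; simp)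
  refine ⟨HahnSeries.single (1 - n) b, ?_, ?_⟩
  · rw [absK_single _ hb0, neg_sub]
  · rw [psiK, mul_comm, HahnSeries.coeff_single_mul, sub_sub_cancel]
    exact hb

end Character

section Haar

variable {Fq}

lemma measurable_add_left_KinfMS (a : Kinf Fq) :
    @Measurable _ _ (KinfMS Fq) (KinfMS Fq) (a + ·) := by
  let := KinfMS Fq
  refine measurable_generateFrom ?_
  rintro _ ⟨b, n, rfl⟩
  refine MeasurableSpace.measurableSet_generateFrom ⟨b - a, n, ?_⟩
  ext x
  simp only [Set.mem_preimage, Set.mem_ofPred_eq]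
  rw [show a + x - b = x - (b - a) by ring]

lemma IsHaar.measurePreserving_add_left {μ : @Measure (Kinf Fq) (KinfMS Fq)}
    (hμ : IsHaar Fq μ) (a : Kinf Fq) :
    @MeasurePreserving _ _ (KinfMS Fq) (KinfMS Fq) (a + ·) μ μ := by
  let := KinfMS Fq
  refine ⟨measurable_add_left_KinfMS a, Measure.ext fun s hs => ?_⟩
  rw [Measure.map_apply (measurable_add_left_KinfMS a) hs, hμ.1]

lemma IsHaar.sigmaFinite {μ : @Measure (Kinf Fq) (KinfMS Fq)} (hμ : IsHaar Fq μ) :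
    @SigmaFinite _ (KinfMS Fq) μ := by
  let := KinfMS Fq
  let S : Polynomial Fq → Set (Kinf Fq) := fun p => {x | absK Fq (x - polyToK Fq p) < 1}
  have : Countable (Polynomial Fq) :=
    Cardinal.mk_le_aleph0_iff.1 <|
      Polynomial.cardinalMk_le_max.trans (max_le Cardinal.mk_le_aleph0 le_rfl)
  refine Measure.sigmaFinite_of_countable (Set.countable_range S) ?_ ?_
  · rintro _ ⟨p, rfl⟩
    have h : S p = (-polyToK Fq p + ·) ⁻¹' {x | absK Fq x < 1} := by
      ext x
      simp [S, sub_eq_neg_add]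
    rw [h, hμ.1, hμ.2]
    exact ENNReal.one_lt_top
  · refine Set.eq_univ_of_forall fun x => ?_
    obtain ⟨p, hp⟩ := exists_absK_sub_polyToK_lt_one x
    exact ⟨S p, ⟨p, rfl⟩, hp⟩

/-- A function on `K_∞⁴` that is multiplied by a constant other than `1` under some translation
has integral zero. -/
lemma IsHaar.integral_pi_eq_zero {μ : @Measure (Kinf Fq) (KinfMS Fq)} (hμ : IsHaar Fq μ)
    {H : (Fin 4 → Kinf Fq) → ℂ} (a : Fin 4 → Kinf Fq) {z : ℂ} (hz : z ≠ 1)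
    (hH : ∀ v, H (fun i => a i + v i) = z * H v) :
    letI := KinfMS Fq
    ∫ v, H v ∂(Measure.pi fun _ : Fin 4 => μ) = 0 := by
  let := KinfMS Fq
  have := hμ.sigmaFinite
  have hadd := hμ.measurePreserving_add_left
  let e : (Fin 4 → Kinf Fq) ≃ᵐ (Fin 4 → Kinf Fq) := MeasurableEquiv.piCongrRight fun i =>
    { toEquiv := Equiv.addLeft (a i)
      measurable_toFun := (hadd (a i)).measurable
      measurable_invFun := (hadd (-a i)).measurable }
  have he : MeasurePreserving e (Measure.pi fun _ : Fin 4 => μ) (Measure.pi fun _ => μ) :=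
    measurePreserving_pi _ _ fun i => hadd (a i)
  have h := he.integral_comp' H
  have hH' : ∀ v, H (e v) = z * H v := hH
  simp only [hH', integral_const_mul] at h
  have h0 : (z - 1) * ∫ v, H v ∂(Measure.pi fun _ : Fin 4 => μ) = 0 := by
    rw [sub_mul, h, one_mul, sub_self]
  exact (mul_eq_zero.1 h0).resolve_left (sub_ne_zero.2 hz)

end Haar

section Morgenstern

variable {Fq}

lemma absK_polyToK_le {p : Polynomial Fq} {n : ℕ} (hp : p.natDegree ≤ n) :
    absK Fq (polyToK Fq p) ≤ (Fintype.card Fq : ℝ) ^ (n : ℤ) := by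
  by_cases h : p = 0
  · simp [h, absK]
  · rw [absK_polyToK h]
    exact zpow_le_zpow_right₀ one_lt_card_cast.le (by omega)

lemma natDegree_eta_le (ν : Fq) (i : Fin 4) : (eta Fq ν i).natDegree ≤ 1 := by
  fin_cases i <;> simp only [_root_.eta] <;> simp <;> compute_degree

lemma absK_FmK_le (ν : Fq) {v : Fin 4 → Kinf Fq} {n : ℤ}
    (hv : ∀ i, absK Fq (v i) ≤ (Fintype.card Fq : ℝ) ^ n) :
    absK Fq (FmK Fq ν v) ≤ (Fintype.card Fq : ℝ) ^ (2 * n + 1) := by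
  refine absK_sum_le _ _ (zpow_pos card_cast_pos _).le fun i _ => ?_
  have h : (Fintype.card Fq : ℝ) ^ (2 * n + 1) =
      (Fintype.card Fq : ℝ) ^ ((1 : ℕ) : ℤ) * ((Fintype.card Fq : ℝ) ^ n) ^ 2 := by
    rw [← zpow_natCast (_ ^ n), ← zpow_mul, ← zpow_add₀ card_cast_pos.ne']
    congr 1
    push_cast
    ring
  rw [absK_mul, absK_pow, h]
  exact mul_le_mul (absK_polyToK_le (natDegree_eta_le ν i))
    (pow_le_pow_left₀ (absK_nonneg _) (hv i) 2) (sq_nonneg _) (zpow_pos card_cast_pos _).le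

/-- Completing the square in `G`. -/
lemma sq_mul_Gfun (ν : Fq) {g f : Polynomial Fq} (hg : g ≠ 0) {lam : Fin 4 → Polynomial Fq}
    (hdvd : g ∣ f - FmP Fq ν lam) (v : Fin 4 → Kinf Fq) :
    polyToK Fq g ^ 2 * Gfun Fq ν g f lam v =
      FmK Fq ν (fun i => polyToK Fq g * v i + polyToK Fq (lam i)) - polyToK Fq f := by
  have hg' := polyToK_ne_zero hg
  have hk : polyToK Fq g * polyToK Fq (kdat Fq ν g f lam) =
      polyToK Fq f - ∑ i, polyToK Fq (eta Fq ν i) * polyToK Fq (lam i) ^ 2 := by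
    rw [← map_mul, kdat, EuclideanDomain.mul_div_cancel' hg hdvd, map_sub, FmP, map_sum]
    simp only [map_mul, map_pow]
  have h : polyToK Fq g ^ 2 * Gfun Fq ν g f lam v = polyToK Fq g ^ 2 * FmK Fq ν v +
      2 * polyToK Fq g * (∑ i, polyToK Fq (eta Fq ν i * lam i) * v i) -
      polyToK Fq g * polyToK Fq (kdat Fq ν g f lam) := by
    rw [Gfun]
    field_simp
    ring
  rw [h, hk]
  simp only [FmK, Fin.sum_univ_four, map_mul]
  ring

lemma wInd_eq_ite {f : Polynomial Fq} (hf : f ≠ 0) {D : ℕ} (hD : f.natDegree = D + D)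
    (x : Fin 4 → Kinf Fq) :
    wInd Fq f x = if ∀ i, absK Fq (x i) ≤ (Fintype.card Fq : ℝ) ^ (D : ℤ) then 1 else 0 := by
  have hnn : 0 ≤ normV Fq x := (absK_nonneg (x 0)).trans
    (Finset.le_sup' (fun i => absK Fq (x i)) (Finset.mem_univ 0))
  have hsq : absK Fq (polyToK Fq f) = ((Fintype.card Fq : ℝ) ^ (D : ℤ)) ^ 2 := by
    rw [absK_polyToK hf, hD, zpow_natCast, zpow_natCast, ← pow_mul]
    congr 1
    ring
  refine if_congr ?_ rfl rfl
  rw [hsq, pow_le_pow_iff_left₀ hnn (zpow_pos card_cast_pos _).le two_ne_zero]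
  simp only [normV, Finset.sup'_le_iff, Finset.mem_univ, true_implies]

/-- On the support of `w`, the cutoff in `h` is automatically satisfied. -/
lemma hwt_mul_wInd (ν : Fq) {g f : Polynomial Fq} (hg : g ≠ 0) (hf : f ≠ 0)
    {lam : Fin 4 → Polynomial Fq} (hdvd : g ∣ f - FmP Fq ν lam) {r : Polynomial Fq}
    (hr : (Fintype.card Fq : ℝ) ^ (Qdeg Fq f g - 3) < absK Fq (polyToK Fq r))
    (heven : Even f.natDegree) (v : Fin 4 → Kinf Fq) :
    hwt Fq (polyToK Fq r / tK Fq ^ Qdeg Fq f g)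
        (Gfun Fq ν g f lam v / tK Fq ^ (2 * Qdeg Fq f g)) *
      wInd Fq f (fun i => polyToK Fq g * v i + polyToK Fq (lam i)) =
    (absK Fq (polyToK Fq r / tK Fq ^ Qdeg Fq f g))⁻¹ *
      wInd Fq f (fun i => polyToK Fq g * v i + polyToK Fq (lam i)) := by
  obtain ⟨D, hD⟩ := heven
  rw [wInd_eq_ite hf hD]
  split_ifs with hv
  swap
  · simp
  have hq := card_cast_pos (Fq := Fq)
  have hF : absK Fq (polyToK Fq g ^ 2 * Gfun Fq ν g f lam v) ≤
      (Fintype.card Fq : ℝ) ^ (2 * (D : ℤ) + 1) := by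
    rw [sq_mul_Gfun ν hg hdvd, sub_eq_add_neg]
    refine absK_add_le (absK_FmK_le ν hv) ?_
    rw [absK_neg, absK_polyToK hf]
    exact zpow_le_zpow_right₀ one_lt_card_cast.le (by omega)
  rw [absK_mul, absK_pow, absK_polyToK hg, ← zpow_natCast (_ ^ _), ← zpow_mul, mul_comm,
    ← le_div_iff₀ (zpow_pos hq _), ← zpow_sub₀ hq.ne'] at hF
  have hlt : absK Fq (Gfun Fq ν g f lam v / tK Fq ^ (2 * Qdeg Fq f g)) <
      absK Fq (polyToK Fq r / tK Fq ^ Qdeg Fq f g) := by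
    rw [absK_div, absK_div, absK_tK_zpow, absK_tK_zpow, div_lt_div_iff₀ (zpow_pos hq _)
      (zpow_pos hq _)]
    calc _ ≤ (Fintype.card Fq : ℝ) ^ (2 * (D : ℤ) + 1 - (g.natDegree : ℤ) * ((2 : ℕ) : ℤ)) *
          (Fintype.card Fq : ℝ) ^ Qdeg Fq f g :=
          mul_le_mul_of_nonneg_right hF (zpow_pos hq _).le
      _ = (Fintype.card Fq : ℝ) ^ (Qdeg Fq f g - 3) *
          (Fintype.card Fq : ℝ) ^ (2 * Qdeg Fq f g) := by
          rw [← zpow_add₀ hq.ne', ← zpow_add₀ hq.ne']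
          congr 1
          simp only [Qdeg, Rdeg]
          push_cast
          omega
      _ < _ := mul_lt_mul_of_pos_right hr (zpow_pos hq _)
  rw [hwt, if_pos hlt]

lemma wInd_add {f : Polynomial Fq} (hf : f ≠ 0) {D : ℕ} (hD : f.natDegree = D + D)
    {b : Fin 4 → Kinf Fq} (hb : ∀ i, absK Fq (b i) ≤ (Fintype.card Fq : ℝ) ^ (D : ℤ))
    (x : Fin 4 → Kinf Fq) : wInd Fq f (fun i => b i + x i) = wInd Fq f x := by
  rw [wInd_eq_ite hf hD, wInd_eq_ite hf hD]
  refine if_congr (forall_congr' fun i => ⟨fun h => ?_, fun h => absK_add_le (hb i) h⟩) rfl rfl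
  rw [← neg_add_cancel_left (b i) (x i)]
  exact absK_add_le (by rw [absK_neg]; exact hb i) h

end Morgenstern

/-- **Vanishing of `I_{g,r}(c⃗)` on the critical circle for `deg f` even.**
If `q^{Q−3} < |r| ≤ q^Q`, `κ = |r|/q^R` and `deg f` is even, then `I_{g,r}(c⃗) = 0`. -/
theorem stmt_4 (μ : @Measure (Kinf Fq) (KinfMS Fq)) (hμ : IsHaar Fq μ)
    (hodd : Odd (Fintype.card Fq)) (ν : Fq) (hν : ¬IsSquare ν)
    (g f : Polynomial Fq) (hg : g ≠ 0) (hf : f ≠ 0)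
    (lam : Fin 4 → Polynomial Fq) (hlam : ∀ i, (lam i).degree < g.degree)
    (hdvd : g ∣ (f - FmP Fq ν lam))
    (r : Polynomial Fq) (hr : r.Monic)
    (hr1 : (Fintype.card Fq : ℝ) ^ (Qdeg Fq f g - 3) < absK Fq (polyToK Fq r))
    (hr2 : absK Fq (polyToK Fq r) ≤ (Fintype.card Fq : ℝ) ^ Qdeg Fq f g)
    (c : Fin 4 → Polynomial Fq)
    (hκ : kappaC Fq g c = absK Fq (polyToK Fq r) / (Fintype.card Fq : ℝ) ^ Rdeg Fq f g)
    (heven : Even f.natDegree) :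
    Igr Fq μ ν g f lam r c = 0 := by
  obtain ⟨D, hD⟩ := id heven
  have hq := card_cast_pos (Fq := Fq)
  have hr0 := polyToK_ne_zero hr.ne_zero
  obtain ⟨j, -, hj⟩ := Finset.exists_mem_eq_sup' (Finset.univ_nonempty (α := Fin 4))
    fun i => absK Fq (polyToK Fq (c i) / polyToK Fq g)
  have hd : absK Fq (polyToK Fq (c j) / (polyToK Fq g * polyToK Fq r)) =
      (Fintype.card Fq : ℝ) ^ (-Rdeg Fq f g) := by
    rw [← div_div, absK_div, ← hj]
    change kappaC Fq g c / _ = _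
    rw [hκ, zpow_neg, div_div, mul_comm, ← div_div, div_self (absK_pos hr0).ne', one_div]
  obtain ⟨a, ha, hψ⟩ := exists_psiK_mul_ne_one hd
  have hb : ∀ i, absK Fq (polyToK Fq g * (Pi.single j a : Fin 4 → Kinf Fq) i) ≤
      (Fintype.card Fq : ℝ) ^ (D : ℤ) := by
    intro i
    by_cases hij : i = j
    · subst hij
      rw [Pi.single_eq_same, absK_mul, absK_polyToK hg, ha, ← zpow_add₀ hq.ne']
      refine zpow_le_zpow_right₀ one_lt_card_cast.le ?_
      simp only [Rdeg]
      omega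
    · rw [Pi.single_eq_of_ne hij, mul_zero]
      simp [absK]
  unfold Igr
  simp only [hwt_mul_wInd ν hg hf hdvd hr1 heven]
  refine hμ.integral_pi_eq_zero (Pi.single j a) hψ fun v => ?_
  have hw : wInd Fq f (fun i => polyToK Fq g * ((Pi.single j a : Fin 4 → Kinf Fq) i + v i) +
      polyToK Fq (lam i)) = wInd Fq f fun i => polyToK Fq g * v i + polyToK Fq (lam i) := by
    simpa only [mul_add, add_assoc] using wInd_add hf hD hb fun i =>
      polyToK Fq g * v i + polyToK Fq (lam i)
  have hsum : (∑ i, polyToK Fq (c i) * ((Pi.single j a : Fin 4 → Kinf Fq) i + v i)) /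
      (polyToK Fq g * polyToK Fq r) =
      polyToK Fq (c j) / (polyToK Fq g * polyToK Fq r) * a +
      (∑ i, polyToK Fq (c i) * v i) / (polyToK Fq g * polyToK Fq r) := by
    simp only [mul_add, Finset.sum_add_distrib, add_div, Pi.single_apply, mul_ite, mul_zero,
      Finset.sum_ite_eq', Finset.mem_univ, if_true]
    rw [div_mul_eq_mul_div]
  rw [hw, hsum, psiK_add]
  ring

end
end

section
/- Let q be an odd prime power, let g ∈ 𝔽_q[t] be irreducible with gcd(g, t(t−1)) = 1, let λ ∈ 𝔽_q[t]⁴ have all coordinates of degree < de g g with at least one coordinate coprime to g, and let A = diag(1, −ν, −(t−1), ν(t−1)) with ν ∈ 𝔽_q a non-square. Then for every real θ with −1 < θ < 0 there is a constant C(θ, q) such that for every integer T with 0 ≤ T ≤ deg g, ∑_{c⃗} |c⃗|^θ ≤ C(θ,q)·q^{T(θ+1)}, where the sum is over those c⃗ ∈ 𝔽_q[t]⁴ with 0 < |c⃗| ≤ q^T for which there exists β ∈ 𝔽_q[t] with c⃗ ≡ 2·β·A·λ (mod g). -/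
open Polynomial
open scoped Classical

noncomputable section

variable (Fq : Type) [Field Fq] [Fintype Fq]

/-- `|p| = q^{deg p}` for a nonzero polynomial, `|0| = 0`. -/
def absP (p : Polynomial Fq) : ℝ :=
  if p = 0 then 0 else (Fintype.card Fq : ℝ) ^ p.natDegree

/-- The sup-norm `|c⃗| = max_i |c_i|` of a quadruple of polynomials. -/
def normVP (c : Fin 4 → Polynomial Fq) : ℝ :=
  Finset.univ.sup' Finset.univ_nonempty fun i => absP Fq (c i)

lemma natDegree_le_of_mem_polysLT {d : ℕ} {p : Polynomial Fq} (hp : p ∈ polysLT Fq (d + 1)) :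
    p.natDegree ≤ d := by
  obtain ⟨c, -, rfl⟩ := Finset.mem_image.1 hp
  refine natDegree_sum_le_of_forall_le _ _ fun i _ => ?_
  exact (natDegree_C_mul_X_pow_le _ _).trans (Nat.lt_succ_iff.1 i.2)

/-- The norm of a nonzero vector is at least `q` to the largest coordinate degree. -/
lemma card_pow_le_normVP {c : Fin 4 → Polynomial Fq} (hc : c ≠ 0) :
    (Fintype.card Fq : ℝ) ^ (Finset.univ.sup fun i => (c i).natDegree) ≤ normVP Fq c := by
  obtain ⟨j, hj0, hj⟩ : ∃ j, c j ≠ 0 ∧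
      (c j).natDegree = Finset.univ.sup fun i => (c i).natDegree := by
    obtain ⟨k, hk⟩ := Function.ne_iff.1 hc
    obtain ⟨j, -, hj⟩ := Finset.exists_mem_eq_sup Finset.univ Finset.univ_nonempty
      fun i => (c i).natDegree
    by_cases h : c j = 0
    · refine ⟨k, hk, ?_⟩
      have hle := Finset.le_sup (f := fun i => (c i).natDegree) (Finset.mem_univ k)
      rw [hj, h, natDegree_zero] at hle ⊢
      exact Nat.le_zero.1 hle
    · exact ⟨j, h, hj.symm⟩
  rw [← hj]
  refine le_trans ?_ (Finset.le_sup' (fun i => absP Fq (c i)) (Finset.mem_univ j))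
  simp [absP, hj0]

lemma isCoprime_eta {K : Type} [Field K] {ν : K} (hν : ν ≠ 0) {g : Polynomial K}
    (hg : IsCoprime g (Polynomial.X * (Polynomial.X - 1))) (i : Fin 4) :
    IsCoprime g (eta K ν i) := by
  have hX : IsCoprime g (Polynomial.X - 1) := hg.of_mul_right_right
  have hC : IsCoprime g (Polynomial.C ν) :=
    (isCoprime_one_right (x := g)).of_isCoprime_of_dvd_right
      (isUnit_iff_dvd_one.1 (isUnit_C.2 hν.isUnit))
  fin_cases i
  · exact isCoprime_one_right
  · exact hC.neg_right
  · exact hX.neg_right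
  · exact hC.mul_right hX

/-- There are at most `q ^ (s + 5)` vectors with coordinates of degree at most `s ≤ deg g` that
are congruent modulo `g` to a multiple of a vector having a coordinate coprime to `g`. -/
lemma card_le_of_congruent_multiple {g : Polynomial Fq} (hg : g ≠ 0) {v : Fin 4 → Polynomial Fq}
    {i : Fin 4} (hi : IsCoprime g (v i)) {s : ℕ} (hs : s ≤ g.natDegree)
    {S : Finset (Fin 4 → Polynomial Fq)} (hdeg : ∀ c ∈ S, ∀ j, (c j).natDegree ≤ s)
    (hS : ∀ c ∈ S, ∃ β, ∀ j, g ∣ c j - β * v j) :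
    S.card ≤ Fintype.card Fq ^ (s + 5) := by
  let f : (Fin 4 → Polynomial Fq) → (Fin (s + 1) → Fq) × (Fin 4 → Fq) := fun c =>
    (fun k => (c i).coeff k, fun j => (c j).coeff g.natDegree)
  have hf : Set.InjOn f S := by
    intro c hc c' hc' h
    have hci : c i = c' i := by
      ext k
      by_cases hk : k < s + 1
      · exact congrFun (congrArg Prod.fst h) ⟨k, hk⟩
      · rw [coeff_eq_zero_of_natDegree_lt (by have := hdeg c hc i; omega),
          coeff_eq_zero_of_natDegree_lt (by have := hdeg c' hc' i; omega)]
    obtain ⟨β, hβ⟩ := hS c hc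
    obtain ⟨β', hβ'⟩ := hS c' hc'
    have hββ' : g ∣ β - β' := by
      refine hi.dvd_of_dvd_mul_right ?_
      have := dvd_sub (hβ' i) (hβ i)
      rw [hci] at this
      convert this using 1
      ring
    funext j
    have hdvd : g ∣ c j - c' j := by
      convert dvd_add (dvd_sub (hβ j) (hβ' j)) (hββ'.mul_right (v j)) using 1
      ring
    refine sub_eq_zero.1 (eq_zero_of_dvd_of_degree_lt hdvd ?_)
    rw [degree_eq_natDegree hg, degree_lt_iff_coeff_zero]
    intro m hm
    rw [coeff_sub]
    rcases hm.eq_or_lt with rfl | hm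
    · exact sub_eq_zero.2 (congrFun (congrArg Prod.snd h) j)
    · rw [coeff_eq_zero_of_natDegree_lt (by have := hdeg c hc j; omega),
        coeff_eq_zero_of_natDegree_lt (by have := hdeg c' hc' j; omega), sub_zero]
  refine (Finset.card_le_card_of_injOn f (fun _ _ => Finset.mem_univ _) hf).trans_eq ?_
  simp only [Finset.card_univ, Fintype.card_prod, Fintype.card_fun, Fintype.card_fin]
  ring

/-- **Counting exceptional frequencies.** For `−1 < θ < 0` there is `C = C(θ,q)` so that for all
irreducible `g` coprime to `t(t−1)`, all admissible `λ`, and all `0 ≤ T ≤ deg g`,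
`∑ |c⃗|^θ ≤ C·q^{T(θ+1)}`, the sum being over `0 < |c⃗| ≤ q^T` with
`c⃗ ≡ 2βAλ (mod g)` for some `β ∈ 𝔽_q[t]`. -/
theorem stmt_11 (hodd : Odd (Fintype.card Fq)) (ν : Fq) (hν : ¬IsSquare ν)
    (θ : ℝ) (hθ1 : -1 < θ) (hθ2 : θ < 0) :
    ∃ C : ℝ, ∀ g : Polynomial Fq, Irreducible g →
      IsCoprime g (Polynomial.X * (Polynomial.X - 1)) →
      ∀ lam : Fin 4 → Polynomial Fq, (∀ i, (lam i).degree < g.degree) →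
      (∃ i, IsCoprime (lam i) g) →
      ∀ T : ℕ, T ≤ g.natDegree →
        ∑ c ∈ (Fintype.piFinset fun _ : Fin 4 => polysLT Fq (T + 1)).filter
            (fun c => c ≠ 0 ∧ ∃ β : Polynomial Fq,
              ∀ i, g ∣ (c i - 2 * β * eta Fq ν i * lam i)),
          (normVP Fq c) ^ θ ≤ C * (Fintype.card Fq : ℝ) ^ ((T : ℝ) * (θ + 1)) := by
  have hν0 : ν ≠ 0 := by
    rintro rfl
    exact hν IsSquare.zero
  have h2 : (2 : Fq) ≠ 0 := by
    refine Ring.two_ne_zero fun h => ?_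
    have := FiniteField.even_card_of_char_two h
    rw [Nat.odd_iff] at hodd
    omega
  set q : ℝ := (Fintype.card Fq : ℝ) with hq
  have hq1 : 1 < q := Nat.one_lt_cast.2 Fintype.one_lt_card
  have hq0 : 0 < q := one_pos.trans hq1
  set r : ℝ := q ^ (θ + 1) with hr
  have hr1 : 1 < r := Real.one_lt_rpow hq1 (by linarith)
  have hqr (s : ℕ) : q ^ ((s : ℝ) * (θ + 1)) = r ^ s := by
    rw [hr, mul_comm, Real.rpow_mul hq0.le, Real.rpow_natCast]
  refine ⟨q ^ 5 * (r / (r - 1)), fun g hg hgX lam _ ⟨i, hi⟩ T hT => ?_⟩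
  have hv : IsCoprime g (2 * eta Fq ν i * lam i) := by
    have hC : IsCoprime g (2 : Polynomial Fq) :=
      (isCoprime_one_right (x := g)).of_isCoprime_of_dvd_right
        (isUnit_iff_dvd_one.1 (isUnit_C.2 h2.isUnit))
    exact (hC.mul_right (isCoprime_eta hν0 hgX i)).mul_right hi.symm
  set S := (Fintype.piFinset fun _ : Fin 4 => polysLT Fq (T + 1)).filter
    (fun c => c ≠ 0 ∧ ∃ β : Polynomial Fq, ∀ i, g ∣ (c i - 2 * β * eta Fq ν i * lam i)) with hS
  let m : (Fin 4 → Polynomial Fq) → ℕ := fun c => Finset.univ.sup fun i => (c i).natDegree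
  have hm : ∀ c ∈ S, m c ∈ Finset.range (T + 1) := by
    intro c hc
    rw [Finset.mem_range, Nat.lt_succ_iff]
    refine Finset.sup_le fun j _ => natDegree_le_of_mem_polysLT Fq ?_
    exact Fintype.mem_piFinset.1 (Finset.mem_filter.1 hc).1 j
  rw [hqr, ← Finset.sum_fiberwise_of_maps_to hm]
  calc
    _ ≤ ∑ s ∈ Finset.range (T + 1), q ^ 5 * r ^ s := by
      refine Finset.sum_le_sum fun s hs => ?_
      have hcard : (S.filter fun c => m c = s).card ≤ Fintype.card Fq ^ (s + 5) := by
        refine card_le_of_congruent_multiple Fq hg.ne_zero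
          (v := fun j => 2 * eta Fq ν j * lam j) hv
          ((Nat.lt_succ_iff.1 (Finset.mem_range.1 hs)).trans hT) (fun c hc j => ?_)
          fun c hc => ?_
        · rw [← (Finset.mem_filter.1 hc).2]
          exact Finset.le_sup (f := fun i => (c i).natDegree) (Finset.mem_univ j)
        · obtain ⟨-, β, hβ⟩ := (Finset.mem_filter.1 (Finset.mem_filter.1 hc).1).2
          refine ⟨β, fun j => ?_⟩
          convert hβ j using 2
          ring
      have hterm : ∀ c ∈ S.filter (fun c => m c = s), normVP Fq c ^ θ ≤ (q ^ s) ^ θ := by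
        intro c hc
        obtain ⟨hcS, rfl⟩ := Finset.mem_filter.1 hc
        exact Real.rpow_le_rpow_of_nonpos (pow_pos hq0 _)
          (card_pow_le_normVP Fq (Finset.mem_filter.1 hcS).2.1) hθ2.le
      refine (Finset.sum_le_card_nsmul _ _ _ hterm).trans ?_
      rw [nsmul_eq_mul]
      have hcard' : ((S.filter fun c => m c = s).card : ℝ) ≤ q ^ (s + 5) := by
        rw [hq, ← Nat.cast_pow]
        exact Nat.cast_le.2 hcard
      refine (mul_le_mul_of_nonneg_right hcard' (by positivity)).trans_eq ?_
      rw [hr, Real.rpow_add_one hq0.ne', mul_pow, ← Real.rpow_natCast (q ^ θ) s,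
        ← Real.rpow_natCast_mul hq0.le, ← Real.rpow_mul hq0.le, mul_comm θ]
      ring
    _ = q ^ 5 * ((r ^ (T + 1) - 1) / (r - 1)) := by
      rw [← Finset.mul_sum, geom_sum_eq hr1.ne']
    _ ≤ q ^ 5 * (r ^ (T + 1) / (r - 1)) := by
      have : 0 < r - 1 := sub_pos.2 hr1
      gcongr
      linarith
    _ = q ^ 5 * (r / (r - 1)) * r ^ T := by ring

end
end
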